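/- arXiv:2207.14544 — 2 statements merged into one kernel-verified Lean document; each statement's English description precedes it below -/
import Mathlib

section
/- For all integers m, n, t > 0 and all integers a, b with 0 ≤ b ≤ a ≤ n−t such that mn − i + a − b ≠ 0 for every i ∈ {1,…,n−t+1}, the number of small (m,t)-Schröder paths S of height n with dg(S) = a and cd(S) = b equals Σ_{i=1}^{n−t+1} ( (n−i)(mn−i+a+1)/(n(mn−i+a−b)) − (n−t−i+1)/(n−t+1) + (b+1)(m−1)/(mn−i+a−b) ) · C(mn−i+a−b, a−b)·C(n−t+1, n−t−i+1)·C(mn, i−a−1), as an identity in ℚ. -/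
/-- A step of a lattice path: north `(0,1)`, east `(1,0)` or diagonal `(1,1)`. -/
inductive Step : Type
  | N : Step
  | E : Step
  | D : Step
  deriving DecidableEq

/-- The displacement vector of a step. -/
def stepVec : Step → ℤ × ℤ
  | .N => (0, 1)
  | .E => (1, 0)
  | .D => (1, 1)

/-- The lattice point reached after the first `k` steps of the path `P` (starting at the
origin). -/
def pt (P : List Step) (k : ℕ) : ℤ × ℤ := ((P.take k).map stepVec).sum

/-- The path `P` starts with at least `t` north steps. -/
def StartsNorth (t : ℤ) (P : List Step) : Prop := List.replicate t.toNat Step.N <+: P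

/-- The path `P` stays weakly above the line `x = m·y`. -/
def AboveLine (m : ℤ) (P : List Step) : Prop := ∀ k : ℕ, (pt P k).1 ≤ m * (pt P k).2

/-- An `(m,t)`-Schröder path of height `n`: a lattice path from `(0,0)` to `(mn,n)` using
north, east and diagonal steps, starting with at least `t` north steps and never going
below the line `x = m·y`. -/
def IsSchroeder (m n t : ℤ) (P : List Step) : Prop :=
  StartsNorth t P ∧ pt P P.length = (m * n, n) ∧ AboveLine m P

/-- An `(m,t)`-Dyck path of height `n`: an `(m,t)`-Schröder path of height `n` with no
diagonal steps. -/
def IsDyck (m n t : ℤ) (P : List Step) : Prop :=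
  IsSchroeder m n t P ∧ ∀ s ∈ P, s ≠ Step.D

/-- A Schröder path is small if none of its diagonal steps starts on the line `x = m·y`. -/
def IsSmall (m : ℤ) (P : List Step) : Prop :=
  ∀ j : ℕ, P[j]? = some Step.D → (pt P j).1 ≠ m * (pt P j).2

/-- A Schröder path is positive if it touches the line `x = m·y` only at its two
endpoints. -/
def IsPositive (m : ℤ) (P : List Step) : Prop :=
  ∀ k : ℕ, 0 < k → k < P.length → (pt P k).1 ≠ m * (pt P k).2

/-- The set of indices `j` such that the `j`-th step of `P` is east and the `(j+1)`-st is
north; the corresponding valley point is `pt P (j+1)`. -/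
def valleys (P : List Step) : Finset ℕ :=
  (Finset.range P.length).filter fun j => P[j]? = some Step.E ∧ P[j + 1]? = some Step.N

/-- The number of valleys of `P`. -/
def val (P : List Step) : ℕ := (valleys P).card

/-- The number of valleys of `P` whose `x`-coordinate is congruent to `i` modulo `m`. -/
def ival (m i : ℤ) (P : List Step) : ℕ :=
  ((valleys P).filter fun j => (pt P (j + 1)).1 % m = i % m).card

/-- The set of returns of `P`: valleys of the form `(m·i, i)`. -/
def returns (m : ℤ) (P : List Step) : Finset ℕ :=
  (valleys P).filter fun j => (pt P (j + 1)).1 = m * (pt P (j + 1)).2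

/-- The number of returns of `P`. -/
def ret (m : ℤ) (P : List Step) : ℕ := (returns m P).card

/-- The set of indices of diagonal steps of `P`. -/
def diags (P : List Step) : Finset ℕ :=
  (Finset.range P.length).filter fun j => P[j]? = some Step.D

/-- The number of diagonal steps of `P`. -/
def dg (P : List Step) : ℕ := (diags P).card

/-- A Schröder path is `m`-divisible if every diagonal step ends at an `x`-coordinate
divisible by `m`. -/
def MDivisible (m : ℤ) (P : List Step) : Prop :=
  ∀ j ∈ diags P, m ∣ (pt P (j + 1)).1

/-- The number of cornered diagonal steps of `P`: diagonal steps connecting `(i·m − 1, i)`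
to `(i·m, i + 1)` for some `i`. -/
def cd (m : ℤ) (P : List Step) : ℕ :=
  ((diags P).filter fun j => (pt P (j + 1)).1 = m * ((pt P (j + 1)).2 - 1)).card

/-- The generalized binomial coefficient `C(p,q) = p(p−1)⋯(p−q+1)/q!` for integers `p` and
`q ≥ 0`, and `C(p,q) = 0` for `q < 0`. -/
def C (p q : ℤ) : ℤ :=
  if q < 0 then 0
  else if 0 ≤ p then (p.toNat.choose q.toNat : ℤ)
  else (-1) ^ q.toNat * ((q - p - 1).toNat.choose q.toNat : ℤ)

section BinomialCoefficients

theorem C_of_neg {p q : ℤ} (hq : q < 0) : C p q = 0 := by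
  simp [C, hq]

theorem C_natCast_right (p : ℤ) (q : ℕ) : C p q = Ring.choose p q := by
  rw [C, if_neg (by lia)]
  split_ifs with hp
  · lift p to ℕ using hp
    simp [Ring.choose_natCast]
  · obtain ⟨r, rfl⟩ : ∃ r : ℕ, p = -r := ⟨(-p).toNat, by lia⟩
    rw [Ring.choose_neg, show (r : ℤ) + q - 1 = ((r + q - 1 : ℕ) : ℤ) by lia, Ring.choose_natCast,
      show ((q : ℤ) - -(r : ℤ) - 1).toNat = r + q - 1 by lia, Units.smul_def, smul_eq_mul,
      Int.coe_negOnePow_natCast, Int.toNat_natCast]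

theorem C_natCast_natCast (p q : ℕ) : C p q = p.choose q := by
  rw [C_natCast_right, Ring.choose_natCast]

theorem mul_ringChoose_sub_one (k : ℤ) (r : ℕ) :
    k * Ring.choose (k - 1) r = (k - r) * Ring.choose k r := by
  have h₁ := Ring.choose_smul_choose k (Nat.le_add_left 1 r)
  have h₂ := Ring.choose_smul_choose k (Nat.le_add_right r 1)
  simp only [Nat.choose_one_right, Ring.choose_one_right, Nat.choose_succ_self_right,
    Nat.add_sub_cancel, Nat.add_sub_cancel_left, Nat.cast_one] at h₁ h₂
  linarith

theorem mul_natChoose (k r : ℕ) :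
    (k + 1 : ℤ) * k.choose r = (k + 1 - r) * (k + 1).choose r := by
  have := mul_ringChoose_sub_one (k + 1 : ℕ) r
  rw [Ring.choose_natCast, show ((k + 1 : ℕ) : ℤ) - 1 = k by lia, Ring.choose_natCast] at this
  exact_mod_cast this

end BinomialCoefficients

section GeneratingSeries

/-- The variable of `ℤ⟦s⟧⟦w⟧` marking diagonal steps; the outer variable `w` marks north steps. -/
noncomputable def diagVar : PowerSeries (PowerSeries ℤ) := PowerSeries.C PowerSeries.X

/-- The series `s ^ b / (1 + s) ^ (b + 1)`. -/
noncomputable def cornerSeries (b : ℕ) : PowerSeries ℤ :=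
  PowerSeries.X ^ b * PowerSeries.binomialSeries ℤ (-(b + 1) : ℤ)

/-- The series `(1 + w + s) ^ M * (1 + w) ^ Q`. -/
noncomputable def trinomialSeries (M Q : ℕ) : PowerSeries (PowerSeries ℤ) :=
  (1 + PowerSeries.X + diagVar) ^ M * (1 + PowerSeries.X) ^ Q

/-- The series `(1 + w + s) ^ M * (1 + w) ^ Q * s ^ b / (1 + s) ^ (b + 1)`. -/
noncomputable def baseSeries (M Q b : ℕ) : PowerSeries (PowerSeries ℤ) :=
  trinomialSeries M Q * PowerSeries.C (cornerSeries b)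

/-- The series whose coefficients of total degree `N` count the completions of paths. -/
noncomputable def countSeries (m M N b : ℕ) : PowerSeries (PowerSeries ℤ) :=
  baseSeries M N b - m * baseSeries M (N + 1) b + m * baseSeries (M - 1) (N + 1) b

/-- The coefficient of `w ^ p * s ^ a`. -/
noncomputable def biCoeff (p a : ℕ) : PowerSeries (PowerSeries ℤ) →+ ℤ where
  toFun F := PowerSeries.coeff a (PowerSeries.coeff p F)
  map_zero' := by simp
  map_add' := by simp

theorem biCoeff_apply (p a : ℕ) (F : PowerSeries (PowerSeries ℤ)) :
    biCoeff p a F = PowerSeries.coeff a (PowerSeries.coeff p F) := rfl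

theorem biCoeff_natCast_mul (p a m : ℕ) (F : PowerSeries (PowerSeries ℤ)) :
    biCoeff p a (m * F) = m * biCoeff p a F := by
  rw [← nsmul_eq_mul, map_nsmul, nsmul_eq_mul]

theorem biCoeff_zero_X_mul (a : ℕ) (F : PowerSeries (PowerSeries ℤ)) :
    biCoeff 0 a (PowerSeries.X * F) = 0 := by
  simp [biCoeff_apply]

theorem biCoeff_succ_X_mul (p a : ℕ) (F : PowerSeries (PowerSeries ℤ)) :
    biCoeff (p + 1) a (PowerSeries.X * F) = biCoeff p a F := by
  simp [biCoeff_apply, PowerSeries.coeff_succ_X_mul]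

theorem biCoeff_zero_diagVar_mul (p : ℕ) (F : PowerSeries (PowerSeries ℤ)) :
    biCoeff p 0 (diagVar * F) = 0 := by
  simp [biCoeff_apply, diagVar, PowerSeries.coeff_C_mul]

theorem biCoeff_succ_diagVar_mul (p a : ℕ) (F : PowerSeries (PowerSeries ℤ)) :
    biCoeff p (a + 1) (diagVar * F) = biCoeff p a F := by
  simp [biCoeff_apply, diagVar, PowerSeries.coeff_C_mul, PowerSeries.coeff_succ_X_mul]

theorem one_add_X_mul_cornerSeries_zero :
    (1 + PowerSeries.X) * cornerSeries 0 = 1 := by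
  have h := PowerSeries.binomialSeries_add (R := ℤ) (A := ℤ) (1 : ℕ) (-1)
  rw [PowerSeries.binomialSeries_nat] at h
  simpa [cornerSeries] using h.symm

theorem one_add_X_mul_cornerSeries_succ (b : ℕ) :
    (1 + PowerSeries.X) * cornerSeries (b + 1) = PowerSeries.X * cornerSeries b := by
  have h := PowerSeries.binomialSeries_add (R := ℤ) (A := ℤ) (1 : ℕ) (-((b + 1 : ℕ) + 1 : ℤ))
  rw [PowerSeries.binomialSeries_nat,
    show ((1 : ℕ) + -((b + 1 : ℕ) + 1) : ℤ) = -(b + 1) by push_cast; ring] at h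
  rw [cornerSeries, cornerSeries, h]
  ring

theorem one_add_diagVar_mul_C_cornerSeries_zero :
    (1 + diagVar) * PowerSeries.C (cornerSeries 0) = 1 := by
  rw [diagVar, ← map_one PowerSeries.C, ← map_add, ← map_mul, one_add_X_mul_cornerSeries_zero]

theorem one_add_diagVar_mul_C_cornerSeries_succ (b : ℕ) :
    (1 + diagVar) * PowerSeries.C (cornerSeries (b + 1)) =
      diagVar * PowerSeries.C (cornerSeries b) := by
  rw [diagVar, ← map_one PowerSeries.C, ← map_add, ← map_mul, ← map_mul,
    one_add_X_mul_cornerSeries_succ]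

theorem countSeries_step (m M N b : ℕ) :
    countSeries m (M + 2) (N + 1) b = countSeries m (M + 1) (N + 1) b
      + PowerSeries.X * countSeries m (M + 2) N b + diagVar * countSeries m (M + 1) N b := by
  simp only [countSeries, baseSeries, trinomialSeries, Nat.add_sub_cancel, Nat.add_succ_sub_one]
  ring

theorem countSeries_corner_succ (m M N b : ℕ) :
    countSeries m (M + 2) (N + 1) (b + 1) = PowerSeries.X * countSeries m (M + 1) N (b + 1)
      + PowerSeries.X * countSeries m (M + 2) N (b + 1)
      + diagVar * countSeries m (M + 1) N b := by
  simp only [countSeries, baseSeries, trinomialSeries, Nat.add_sub_cancel, Nat.add_succ_sub_one]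
  linear_combination ((1 + PowerSeries.X + diagVar) ^ (M + 1) * (1 + PowerSeries.X) ^ N
    - m * (1 + PowerSeries.X + diagVar) ^ (M + 1) * (1 + PowerSeries.X) ^ (N + 1)
    + m * (1 + PowerSeries.X + diagVar) ^ M * (1 + PowerSeries.X) ^ (N + 1)) *
      one_add_diagVar_mul_C_cornerSeries_succ b

theorem countSeries_corner_zero (m M N : ℕ) :
    countSeries m (M + 2) (N + 1) 0 = PowerSeries.X * countSeries m (M + 1) N 0
      + PowerSeries.X * countSeries m (M + 2) N 0
      + (trinomialSeries (M + 1) N - m * trinomialSeries (M + 1) (N + 1)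
        + m * trinomialSeries M (N + 1) : PowerSeries (PowerSeries ℤ)) := by
  simp only [countSeries, baseSeries, trinomialSeries, Nat.add_sub_cancel, Nat.add_succ_sub_one]
  linear_combination ((1 + PowerSeries.X + diagVar) ^ (M + 1) * (1 + PowerSeries.X) ^ N
    - m * (1 + PowerSeries.X + diagVar) ^ (M + 1) * (1 + PowerSeries.X) ^ (N + 1)
    + m * (1 + PowerSeries.X + diagVar) ^ M * (1 + PowerSeries.X) ^ (N + 1)) *
      one_add_diagVar_mul_C_cornerSeries_zero

theorem coeff_one_add_X_pow {R : Type*} [CommRing R] (Q p : ℕ) :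
    PowerSeries.coeff p ((1 + PowerSeries.X : PowerSeries R) ^ Q) = Q.choose p := by
  rw [← PowerSeries.binomialSeries_nat (R := ℤ), PowerSeries.binomialSeries_coeff,
    Ring.choose_natCast]
  simp

theorem biCoeff_trinomialSeries (p a M Q : ℕ) :
    biCoeff p a (trinomialSeries M Q) = M.choose a * (M - a + Q).choose p := by
  induction M generalizing a Q with
  | zero =>
    rw [trinomialSeries, pow_zero, one_mul, biCoeff_apply, coeff_one_add_X_pow,
      ← map_natCast PowerSeries.C, PowerSeries.coeff_C]
    cases a <;> simp
  | succ M ih =>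
    rw [show trinomialSeries (M + 1) Q = trinomialSeries M (Q + 1)
      + diagVar * trinomialSeries M Q by simp only [trinomialSeries]; ring, map_add, ih]
    cases a with
    | zero =>
      rw [biCoeff_zero_diagVar_mul]
      simp [add_right_comm, ← add_assoc]
    | succ a =>
      rw [biCoeff_succ_diagVar_mul, ih, Nat.choose_succ_succ, Nat.add_sub_add_right]
      rcases lt_or_ge M (a + 1) with h | h
      · simp [Nat.choose_eq_zero_of_lt h]
      · rw [show M - (a + 1) + (Q + 1) = M - a + Q by lia]
        push_cast
        ring

theorem biCoeff_euler (m p a N M : ℕ) (hN : p + a = N + 1) (hM : m * (N + 1) = M + 1) :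
    biCoeff p a (trinomialSeries (M + 1) N - m * trinomialSeries (M + 1) (N + 1)
      + m * trinomialSeries M (N + 1)) = 0 := by
  rw [map_add, map_sub, biCoeff_natCast_mul, biCoeff_natCast_mul, biCoeff_trinomialSeries,
    biCoeff_trinomialSeries, biCoeff_trinomialSeries]
  rcases lt_or_ge (M + 1) a with h | h
  · simp [Nat.choose_eq_zero_of_lt h, Nat.choose_eq_zero_of_lt (show M < a by lia)]
  obtain ⟨c, hc⟩ := Nat.exists_eq_add_of_le h
  have h₁ := mul_natChoose M a
  have h₂ := mul_natChoose (c + N) p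
  have h₃ : (M.choose a : ℤ) * (M - a + (N + 1)).choose p = M.choose a * (c + N).choose p := by
    rcases Nat.eq_zero_or_pos c with rfl | hc'
    · simp [Nat.choose_eq_zero_of_lt (show M < a by lia)]
    · rw [show M - a + (N + 1) = c + N by lia]
  rw [h₃, show M + 1 - a = c by lia, ← add_assoc]
  rw [show (M + 1 - a : ℤ) = c by lia] at h₁
  rw [show ((c + N : ℕ) + 1 - p : ℤ) = M + 1 by lia] at h₂
  push_cast at h₂
  have hM' : (m * (N + 1) : ℤ) = M + 1 := mod_cast hM
  refine (mul_eq_zero.mp ?_).resolve_left (show (M + 1 : ℤ) ≠ 0 by lia)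
  linear_combination m * (c + N).choose p * h₁ + m * (M + 1).choose a * h₂
    - (M + 1).choose a * (c + N).choose p * hM'

end GeneratingSeries

section Completions

/-- `Completes m h p a b P` says that, started at height `h` above the line, the path `P` stays
weakly above the line, ends on it, has no diagonal step starting on it, and has `p` north steps
and `a` diagonal steps, `b` of which are cornered. -/
def Completes (m : ℕ) : ℕ → ℕ → ℕ → ℕ → List Step → Prop
  | h, p, a, b, [] => h = 0 ∧ p = 0 ∧ a = 0 ∧ b = 0
  | 0, _, _, _, .E :: _ => False
  | h + 1, p, a, b, .E :: P => Completes m h p a b P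
  | _, 0, _, _, .N :: _ => False
  | h, p + 1, a, b, .N :: P => Completes m (h + m) p a b P
  | _, _, 0, _, .D :: _ => False
  | 0, _, _ + 1, _, .D :: _ => False
  | 1, _, _ + 1, 0, .D :: _ => False
  | 1, p, a + 1, b + 1, .D :: P => Completes m m p a b P
  | h + 2, p, a + 1, b, .D :: P => Completes m (h + 1 + m) p a b P

theorem Completes.length_eq {m h p a b : ℕ} {P : List Step} (hP : Completes m h p a b P) :
    P.length = h + (m + 1) * p + m * a := by
  fun_induction Completes m h p a b P <;> simp_all <;> ring

theorem finite_setOf_completes (m h p a b : ℕ) : {P | Completes m h p a b P}.Finite :=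
  haveI : Finite Step := Set.finite_univ_iff.mp
    ((Set.toFinite {.N, .E, .D}).subset fun s _ ↦ by cases s <;> simp)
  (List.finite_length_eq Step (h + (m + 1) * p + m * a)).subset fun _ ↦ Completes.length_eq

/-- The number of completions. -/
noncomputable def completions (m h p a b : ℕ) : ℕ := {P | Completes m h p a b P}.ncard

theorem ncard_eq_of_nil_notMem {A : Set (List Step)} (hA : A.Finite) (hnil : [] ∉ A) :
    A.ncard = {P | .E :: P ∈ A}.ncard + {P | .N :: P ∈ A}.ncard + {P | .D :: P ∈ A}.ncard := by
  have hfin (s : Step) : {P | s :: P ∈ A}.Finite := hA.preimage (List.cons_injective.injOn)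
  have hcard (s : Step) : (List.cons s '' {P | s :: P ∈ A}).ncard = {P | s :: P ∈ A}.ncard :=
    Set.ncard_image_of_injective _ List.cons_injective
  have hunion : A = (List.cons .E '' {P | .E :: P ∈ A} ∪ List.cons .N '' {P | .N :: P ∈ A}) ∪
      List.cons .D '' {P | .D :: P ∈ A} := by
    ext P
    rcases P with - | ⟨- | - | -, P⟩ <;> simp [hnil]
  rw [← hcard, ← hcard, ← hcard, ← Set.ncard_union_eq _ ((hfin _).image _) ((hfin _).image _),
    ← Set.ncard_union_eq _ (((hfin _).image _).union ((hfin _).image _)) ((hfin _).image _),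
    ← hunion]
  · rw [Set.disjoint_left]
    rintro _ (⟨P, -, rfl⟩ | ⟨P, -, rfl⟩) <;> simp
  · rw [Set.disjoint_left]
    rintro _ ⟨P, -, rfl⟩
    simp

theorem completions_zero_zero_zero_zero (m : ℕ) : completions m 0 0 0 0 = 1 := by
  rw [completions, Set.ncard_eq_one]
  refine ⟨[], Set.ext fun P ↦ ?_⟩
  rcases P with - | ⟨- | - | -, P⟩ <;> simp [Completes]

theorem completions_zero_zero_zero_succ (m b : ℕ) : completions m 0 0 0 (b + 1) = 0 := by
  have : {P | Completes m 0 0 0 (b + 1) P} = ∅ := by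
    ext P
    rcases P with - | ⟨- | - | -, P⟩ <;> simp [Completes]
  rw [completions, this, Set.ncard_empty]

theorem completions_succ_zero_zero (m h b : ℕ) :
    completions m (h + 1) 0 0 b = completions m h 0 0 b := by
  rw [completions, ncard_eq_of_nil_notMem (finite_setOf_completes ..) (by simp [Completes])]
  rcases h with - | h <;> simp [Completes, completions]

theorem completions_zero_zero_succ (m a b : ℕ) : completions m 0 0 (a + 1) b = 0 := by
  have : {P | Completes m 0 0 (a + 1) b P} = ∅ := by
    ext P
    rcases P with - | ⟨- | - | -, P⟩ <;> simp [Completes]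
  rw [completions, this, Set.ncard_empty]

theorem completions_zero_succ (m p a b : ℕ) :
    completions m 0 (p + 1) a b = completions m m p a b := by
  rw [completions, ncard_eq_of_nil_notMem (finite_setOf_completes ..) (by simp [Completes])]
  rcases a with - | a <;> simp [Completes, completions]

theorem completions_succ_north (m h p b : ℕ) :
    completions m (h + 1) (p + 1) 0 b =
      completions m h (p + 1) 0 b + completions m (h + 1 + m) p 0 b := by
  rw [completions, ncard_eq_of_nil_notMem (finite_setOf_completes ..) (by simp [Completes])]
  simp [Completes, completions]

theorem completions_one_diag_zero (m a : ℕ) : completions m 1 0 (a + 1) 0 = 0 := by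
  rw [completions, ncard_eq_of_nil_notMem (finite_setOf_completes ..) (by simp [Completes])]
  simpa [Completes, completions] using completions_zero_zero_succ m a 0

theorem completions_one_diag_succ (m a b : ℕ) :
    completions m 1 0 (a + 1) (b + 1) = completions m m 0 a b := by
  rw [completions, ncard_eq_of_nil_notMem (finite_setOf_completes ..) (by simp [Completes])]
  simpa [Completes, completions] using completions_zero_zero_succ m a (b + 1)

theorem completions_one_zero (m p a : ℕ) : completions m 1 (p + 1) (a + 1) 0 =
    completions m m p (a + 1) 0 + completions m (1 + m) p (a + 1) 0 := by
  rw [← completions_zero_succ, completions,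
    ncard_eq_of_nil_notMem (finite_setOf_completes ..) (by simp [Completes])]
  simp [Completes, completions]

theorem completions_one_succ (m p a b : ℕ) : completions m 1 (p + 1) (a + 1) (b + 1) =
    completions m m p (a + 1) (b + 1) + completions m (1 + m) p (a + 1) (b + 1)
      + completions m m (p + 1) a b := by
  rw [← completions_zero_succ, completions,
    ncard_eq_of_nil_notMem (finite_setOf_completes ..) (by simp [Completes])]
  simp [Completes, completions]

theorem completions_diag (m h a b : ℕ) : completions m (h + 2) 0 (a + 1) b =
    completions m (h + 1) 0 (a + 1) b + completions m (h + 1 + m) 0 a b := by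
  rw [completions, ncard_eq_of_nil_notMem (finite_setOf_completes ..) (by simp [Completes])]
  simp [Completes, completions]

theorem completions_north_diag (m h p a b : ℕ) : completions m (h + 2) (p + 1) (a + 1) b =
    completions m (h + 1) (p + 1) (a + 1) b + completions m (h + 2 + m) p (a + 1) b
      + completions m (h + 1 + m) (p + 1) a b := by
  rw [completions, ncard_eq_of_nil_notMem (finite_setOf_completes ..) (by simp [Completes])]
  simp [Completes, completions]

theorem biCoeff_zero_zero_countSeries (m M N b : ℕ) :
    biCoeff 0 0 (countSeries m M N b) = if b = 0 then 1 else 0 := by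
  have h (M Q : ℕ) : biCoeff 0 0 (baseSeries M Q b) = if b = 0 then 1 else 0 := by
    rcases b with - | b <;>
      simp [biCoeff_apply, baseSeries, trinomialSeries, diagVar, cornerSeries]
  rw [countSeries, map_add, map_sub, biCoeff_natCast_mul, biCoeff_natCast_mul, h, h, h]
  ring

theorem completions_zero_zero (m h b : ℕ) :
    completions m h 0 0 b = if b = 0 then 1 else 0 := by
  induction h with
  | zero =>
    rcases b with - | b
    · simp [completions_zero_zero_zero_zero]
    · simp [completions_zero_zero_zero_succ]
  | succ h ih => rw [completions_succ_zero_zero, ih]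

theorem completions_eq_biCoeff {m h p a b N M : ℕ} (hm : 0 < m) (hh : 0 < h) (hN : p + a = N)
    (hM : h + m * N = M) :
    (completions m h p a b : ℤ) = biCoeff p a (countSeries m M N b) := by
  induction N generalizing h p a b M with
  | zero =>
    obtain ⟨rfl, rfl⟩ : p = 0 ∧ a = 0 := by lia
    rw [completions_zero_zero, biCoeff_zero_zero_countSeries]
    simp
  | succ N ihN =>
    obtain ⟨K, hK⟩ : ∃ K, m * (N + 1) = K + 1 :=
      Nat.exists_eq_add_of_lt (Nat.mul_pos hm N.succ_pos) |>.imp fun _ h ↦ by lia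
    have hmN : m + m * N = K + 1 := by rw [← hK]; ring
    induction h, hh using Nat.le_induction generalizing p a b M with
    | base =>
      obtain rfl : M = K + 2 := by lia
      have h₁ {p a b : ℕ} (h : p + a = N) := ihN (M := K + 1) (b := b) hm h hmN
      have h₂ {p a b : ℕ} (h : p + a = N) :=
        ihN (h := 1 + m) (M := K + 2) (b := b) (by lia) h (by lia)
      rcases b with - | b
      · rw [countSeries_corner_zero, map_add, map_add, biCoeff_euler m p a N K hN hK]
        rcases p with - | p
        · obtain ⟨a, rfl⟩ : ∃ a', a = a' + 1 := ⟨a - 1, by lia⟩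
          simp [completions_one_diag_zero, biCoeff_zero_X_mul]
        · rw [biCoeff_succ_X_mul, biCoeff_succ_X_mul, ← h₁ (by lia), ← h₂ (by lia)]
          rcases a with - | a
          · rw [completions_succ_north m 0, completions_zero_succ]
            simp
          · rw [completions_one_zero]
            simp
      · rw [countSeries_corner_succ, map_add, map_add]
        rcases p with - | p
        · obtain ⟨a, rfl⟩ : ∃ a', a = a' + 1 := ⟨a - 1, by lia⟩
          rw [completions_one_diag_succ, biCoeff_zero_X_mul, biCoeff_zero_X_mul,
            biCoeff_succ_diagVar_mul, ← h₁ (by lia)]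
          simp
        · rw [biCoeff_succ_X_mul, biCoeff_succ_X_mul, ← h₁ (by lia), ← h₂ (by lia)]
          rcases a with - | a
          · rw [completions_succ_north m 0, completions_zero_succ, biCoeff_zero_diagVar_mul]
            simp
          · rw [completions_one_succ, biCoeff_succ_diagVar_mul, ← h₁ (by lia)]
            simp
    | succ h hh ihh =>
      obtain ⟨h, rfl⟩ : ∃ h', h = h' + 1 := ⟨h - 1, by lia⟩
      obtain rfl : M = h + K + 1 + 2 := by lia
      have h₁ {p a b : ℕ} (h' : p + a = N) :=
        ihN (h := h + 2 + m) (M := h + K + 1 + 2) (b := b) (by lia) h' (by lia)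
      have h₂ {p a b : ℕ} (h' : p + a = N) :=
        ihN (h := h + 1 + m) (M := h + K + 1 + 1) (b := b) (by lia) h' (by lia)
      rw [countSeries_step, map_add, map_add, ← ihh hN (by lia)]
      rcases p with - | p
      · obtain ⟨a, rfl⟩ : ∃ a', a = a' + 1 := ⟨a - 1, by lia⟩
        rw [completions_diag, biCoeff_zero_X_mul, biCoeff_succ_diagVar_mul, ← h₂ (by lia)]
        simp
      · rw [biCoeff_succ_X_mul, ← h₁ (by lia)]
        rcases a with - | a
        · rw [completions_succ_north, biCoeff_zero_diagVar_mul]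
          simp
        · rw [completions_north_diag, biCoeff_succ_diagVar_mul, ← h₂ (by lia)]
          simp

end Completions

section Paths

theorem pt_zero (P : List Step) : pt P 0 = 0 := by simp [pt]

theorem pt_cons_succ (s : Step) (P : List Step) (k : ℕ) :
    pt (s :: P) (k + 1) = stepVec s + pt P k := by simp [pt]

/-- The number of diagonal steps of `P` ending at height `m` above the line when `P` is started
at height `h` above it. -/
def cornered (m h : ℤ) (P : List Step) : ℕ :=
  ((diags P).filter fun j ↦ (pt P (j + 1)).1 = h + m * ((pt P (j + 1)).2 - 1)).card

theorem dg_cons (s : Step) (P : List Step) :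
    dg (s :: P) = (if s = .D then 1 else 0) + dg P := by
  simp only [dg, diags, Finset.card_filter, List.length_cons, Finset.sum_range_succ',
    List.getElem?_cons_succ, List.getElem?_cons_zero, Option.some_inj]
  rw [add_comm]

theorem cornered_cons (m h : ℤ) (s : Step) (P : List Step) :
    cornered m h (s :: P) = (if s = .D ∧ h = 1 then 1 else 0)
      + cornered m (h + m * (stepVec s).2 - (stepVec s).1) P := by
  simp only [cornered, diags, Finset.filter_filter, Finset.card_filter, List.length_cons,
    Finset.sum_range_succ', List.getElem?_cons_succ, List.getElem?_cons_zero, Option.some_inj,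
    pt_cons_succ, pt_zero]
  rw [add_comm]
  congr 1
  · rcases s with - | - | - <;> simp [stepVec, eq_comm]
  · refine Finset.sum_congr rfl fun j _ ↦ if_congr (and_congr_right fun _ ↦ ?_) rfl rfl
    simp only [Prod.fst_add, Prod.snd_add]
    constructor <;> intro <;> linarith

theorem pt_length_snd (P : List Step) : (pt P P.length).2 = P.count .N + dg P := by
  induction P with
  | nil => simp [pt, dg, diags]
  | cons s P ih =>
    rw [List.length_cons, pt_cons_succ, Prod.snd_add, ih, dg_cons, List.count_cons]
    rcases s with - | - | - <;> simp [stepVec] <;> ring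

/-- The geometric counterpart of `Completes`, with integer parameters. -/
def IsCompletion (m h p a b : ℤ) (P : List Step) : Prop :=
  (∀ k, (pt P k).1 ≤ h + m * (pt P k).2) ∧
    (pt P P.length).1 = h + m * (pt P P.length).2 ∧
    (∀ j : ℕ, P[j]? = some Step.D → (pt P j).1 ≠ h + m * (pt P j).2) ∧
    (P.count .N : ℤ) = p ∧ (dg P : ℤ) = a ∧ (cornered m h P : ℤ) = b

theorem IsCompletion.nonneg {m h p a b : ℤ} {P : List Step} (hP : IsCompletion m h p a b P) :
    0 ≤ h ∧ 0 ≤ p ∧ 0 ≤ a ∧ 0 ≤ b := by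
  obtain ⟨h₁, -, -, rfl, rfl, rfl⟩ := hP
  simpa [pt_zero] using h₁ 0

theorem isCompletion_nil {m h p a b : ℤ} :
    IsCompletion m h p a b [] ↔ h = 0 ∧ p = 0 ∧ a = 0 ∧ b = 0 := by
  simp [IsCompletion, pt, dg, cornered, diags]
  grind

theorem isCompletion_cons {m h p a b : ℤ} {s : Step} {P : List Step} :
    IsCompletion m h p a b (s :: P) ↔ 0 ≤ h ∧ (s = .D → h ≠ 0) ∧
      IsCompletion m (h + m * (stepVec s).2 - (stepVec s).1) (p - if s = .N then 1 else 0)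
        (a - if s = .D then 1 else 0) (b - if s = .D ∧ h = 1 then 1 else 0) P := by
  rw [IsCompletion, IsCompletion, ← Nat.and_forall_add_one,
    ← Nat.and_forall_add_one (p := fun j : ℕ ↦ (s :: P)[j]? = some Step.D → _), dg_cons,
    cornered_cons, List.count_cons]
  have h₁ (k : ℕ) : (stepVec s).1 + (pt P k).1 ≤ h + m * ((stepVec s).2 + (pt P k).2) ↔
      (pt P k).1 ≤ h + m * (stepVec s).2 - (stepVec s).1 + m * (pt P k).2 := by
    constructor <;> intro <;> linarith
  have h₂ (k : ℕ) : (stepVec s).1 + (pt P k).1 = h + m * ((stepVec s).2 + (pt P k).2) ↔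
      (pt P k).1 = h + m * (stepVec s).2 - (stepVec s).1 + m * (pt P k).2 := by
    constructor <;> intro <;> linarith
  simp only [pt_zero, pt_cons_succ, List.length_cons, List.getElem?_cons_zero,
    List.getElem?_cons_succ, Option.some_inj, Prod.fst_add, Prod.snd_add, Prod.fst_zero,
    Prod.snd_zero, mul_zero, add_zero, h₁, h₂, ne_eq, beq_iff_eq, Nat.cast_add, Nat.cast_ite,
    Nat.cast_one, Nat.cast_zero, eq_sub_iff_add_eq, add_comm (if _ then (1 : ℤ) else 0)]
  rw [eq_comm (a := (0 : ℤ)) (b := h)]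
  tauto

theorem completes_iff_isCompletion (m h p a b : ℕ) (P : List Step) :
    Completes m h p a b P ↔ IsCompletion m h p a b P := by
  fun_induction Completes m h p a b P <;>
    simp_all [isCompletion_nil, isCompletion_cons, stepVec]
  case case3 => lia
  case case10 h p a b P ih =>
    rw [if_neg (by lia), sub_zero, show (h + 1 + 1 + m - 1 : ℤ) = h + 1 + m by ring]
    exact ⟨fun hP ↦ ⟨by lia, by lia, hP⟩, fun hP ↦ hP.2.2⟩
  all_goals
    intros
    intro hP
    have := hP.nonneg
    lia

theorem completes_replicate_append (m h p a b t : ℕ) (P : List Step) :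
    Completes m h (t + p) a b (List.replicate t .N ++ P) ↔ Completes m (h + m * t) p a b P := by
  induction t generalizing h with
  | zero => simp
  | succ t ih =>
    rw [List.replicate_succ, List.cons_append, add_right_comm, Completes, ih, mul_add_one,
      add_assoc, add_comm m]

theorem schroeder_iff_isCompletion (m n t a b : ℤ) (P : List Step) :
    (IsSchroeder m n t P ∧ IsSmall m P ∧ (dg P : ℤ) = a ∧ (cd m P : ℤ) = b) ↔
      StartsNorth t P ∧ IsCompletion m 0 (n - a) a b P := by
  have hcd : cd m P = cornered m 0 P := by simp [cd, cornered]
  have hlen := pt_length_snd P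
  simp only [IsSchroeder, AboveLine, IsSmall, IsCompletion, hcd, Prod.ext_iff, zero_add]
  constructor
  · rintro ⟨⟨h₁, ⟨h₂, h₃⟩, h₄⟩, h₅, h₆, h₇⟩
    exact ⟨h₁, h₄, by rw [h₂, h₃], h₅, by lia, h₆, h₇⟩
  · rintro ⟨h₁, h₄, h₂, h₅, h₃, h₆, h₇⟩
    have h₈ : (pt P P.length).2 = n := by lia
    exact ⟨⟨h₁, ⟨by rw [h₂, h₈], h₈⟩, h₄⟩, h₅, h₆, h₇⟩

theorem ncard_schroeder (m p a b t : ℕ) :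
    {S : List Step | IsSchroeder m (t + p + a : ℕ) t S ∧ IsSmall m S ∧ (dg S : ℤ) = a ∧
      (cd m S : ℤ) = b}.ncard = completions m (m * t) p a b := by
  have h : {S : List Step | IsSchroeder m (t + p + a : ℕ) t S ∧ IsSmall m S ∧ (dg S : ℤ) = a ∧
      (cd m S : ℤ) = b} = (List.replicate t .N ++ ·) '' {P | Completes m (m * t) p a b P} := by
    ext S
    have := completes_iff_isCompletion m 0 (t + p) a b
    rw [Set.mem_ofPred_eq, schroeder_iff_isCompletion,
      show ((t + p + a : ℕ) - a : ℤ) = (t + p : ℕ) by lia, ← Nat.cast_zero, ← this]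
    constructor
    · rintro ⟨⟨P, rfl⟩, hP⟩
      rw [Int.toNat_natCast, completes_replicate_append, zero_add] at hP
      exact ⟨P, hP, by simp⟩
    · rintro ⟨P, hP, rfl⟩
      refine ⟨⟨P, by simp⟩, ?_⟩
      rw [completes_replicate_append, zero_add]
      exact hP
  rw [h, Set.ncard_image_of_injective _ (List.append_right_injective _), completions]

end Paths

section Extraction

theorem coeff_one_add_X_add_diagVar_pow (M k : ℕ) :
    PowerSeries.coeff k ((1 + PowerSeries.X + diagVar) ^ M) =
      (1 + PowerSeries.X) ^ (M - k) * (M.choose k : PowerSeries ℤ) := by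
  rw [← Polynomial.coeff_X_add_C_pow, ← Polynomial.coeff_coe]
  simp [diagVar]
  ring_nf

theorem biCoeff_baseSeries (p a b M Q : ℕ) (hba : b ≤ a) :
    biCoeff p a (baseSeries M Q b) = ∑ j ∈ Finset.range (p + 1),
      (Q.choose j * M.choose (p - j) * Ring.choose (M - (p - j : ℕ) - b - 1 : ℤ) (a - b)) := by
  rw [biCoeff_apply, baseSeries, trinomialSeries, PowerSeries.coeff_mul_C,
    mul_comm (_ ^ M), PowerSeries.coeff_mul p, Finset.Nat.sum_antidiagonal_eq_sum_range_succ
      (fun i j ↦ PowerSeries.coeff i ((1 + PowerSeries.X) ^ Q) *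
        PowerSeries.coeff j ((1 + PowerSeries.X + diagVar) ^ M)), Finset.sum_mul, map_sum]
  refine Finset.sum_congr rfl fun j _ ↦ ?_
  rw [coeff_one_add_X_pow, coeff_one_add_X_add_diagVar_pow]
  rcases lt_or_ge M (p - j) with h | h
  · simp [Nat.choose_eq_zero_of_lt h]
  have hseries : (1 + PowerSeries.X) ^ (M - (p - j)) * cornerSeries b =
      PowerSeries.X ^ b * PowerSeries.binomialSeries ℤ (M - (p - j : ℕ) - b - 1 : ℤ) := by
    rw [cornerSeries, ← PowerSeries.binomialSeries_nat (R := ℤ), mul_left_comm,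
      ← PowerSeries.binomialSeries_add, Nat.cast_sub h]
    congr 2
    ring
  rw [show (Q.choose j : PowerSeries ℤ) * ((1 + PowerSeries.X) ^ (M - (p - j)) *
      (M.choose (p - j) : PowerSeries ℤ)) * cornerSeries b =
      PowerSeries.C (Q.choose j * M.choose (p - j) : ℤ) *
        ((1 + PowerSeries.X) ^ (M - (p - j)) * cornerSeries b) by
      rw [map_mul, map_natCast, map_natCast]; ring,
    hseries, PowerSeries.coeff_C_mul, PowerSeries.coeff_X_pow_mul', if_pos hba,
    PowerSeries.binomialSeries_coeff, smul_eq_mul, mul_one]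

/-- The summand identity behind the closed formula, where `A`, `B` and `K` are binomial
coefficients that determine `A'`, `B'` and `K'`. -/
theorem summand_identity {m n N j c r k i a b A A' B B' K K' : ℚ} (hm : m ≠ 0) (hn : n ≠ 0)
    (hN : N + 1 ≠ 0) (hk : k ≠ 0) (hi : i = N + 1 - j) (hc : i - a - 1 = c) (hr : r = a - b)
    (hki : k = m * n - i + a - b) (hA : (N + 1) * A' = (N + 1 - j) * A)
    (hB : m * n * B' = (m * n - c) * B) (hK : k * K' = (k - r) * K) :
    A' * B * K - m * (A * B * K) + m * (A * B' * K') =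
      ((n - i) * (m * n - i + a + 1) / (n * k) - j / (N + 1) + (b + 1) * (m - 1) / k)
        * K * A * B := by
  obtain rfl : A' = (N + 1 - j) * A / (N + 1) := by field_simp; linarith
  obtain rfl : B' = (m * n - c) * B / (m * n) := by field_simp; linarith
  obtain rfl : K' = (k - r) * K / k := by field_simp; linarith
  subst hc hr
  field_simp
  subst hki hi
  ring

theorem biCoeff_countSeries (m p a b M N : ℕ) (hba : b ≤ a) (hM : 0 < M) :
    biCoeff p a (countSeries m M N b) = ∑ j ∈ Finset.range (p + 1),
      (N.choose j * M.choose (p - j) * Ring.choose (M - (p - j : ℕ) - b - 1 : ℤ) (a - b)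
        - m * ((N + 1).choose j * M.choose (p - j) *
          Ring.choose (M - (p - j : ℕ) - b - 1 : ℤ) (a - b))
        + m * ((N + 1).choose j * (M - 1).choose (p - j) *
          Ring.choose (M - (p - j : ℕ) - b - 1 - 1 : ℤ) (a - b))) := by
  rw [countSeries, map_add, map_sub, biCoeff_natCast_mul, biCoeff_natCast_mul,
    biCoeff_baseSeries _ _ _ _ _ hba, biCoeff_baseSeries _ _ _ _ _ hba,
    biCoeff_baseSeries _ _ _ _ _ hba, Finset.mul_sum, Finset.mul_sum, ← Finset.sum_sub_distrib,
    ← Finset.sum_add_distrib]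
  refine Finset.sum_congr rfl fun j _ ↦ ?_
  rw [show ((M - 1 : ℕ) - (p - j : ℕ) - b - 1 : ℤ) = M - (p - j : ℕ) - b - 1 - 1 by lia]

theorem sum_Icc_one_eq_sum_range (f : ℤ → ℚ) (p a : ℕ)
    (hf : ∀ i, 1 ≤ i → i ≤ (a : ℤ) → f i = 0) :
    ∑ i ∈ Finset.Icc (1 : ℤ) (p + a + 1), f i =
      ∑ j ∈ Finset.range (p + 1), f (p + a + 1 - j) := by
  symm
  refine Finset.sum_of_injOn (fun j : ℕ ↦ (p + a + 1 - j : ℤ)) ?_ ?_ ?_ fun _ _ ↦ rfl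
  · intro x _ y _ h
    simp only at h
    lia
  · intro j hj
    simp only [Finset.coe_range, Set.mem_Iio, Finset.coe_Icc, Set.mem_Icc] at hj ⊢
    lia
  · intro i hi hi'
    rw [Finset.mem_Icc] at hi
    refine hf i hi.1 (not_lt.mp fun h ↦ hi' ⟨(p + a + 1 - i).toNat, ?_, ?_⟩)
    · simp only [Finset.coe_range, Set.mem_Iio]
      lia
    · simp only
      lia

end Extraction

/-- the number of small `(m,t)`-Schröder paths of height `n` with `a`
diagonal steps and `b` cornered diagonal steps. -/
theorem statement6 (m n t a b : ℤ) (hm : 0 < m) (hn : 0 < n) (ht : 0 < t)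
    (hb : 0 ≤ b) (hba : b ≤ a) (ha : a ≤ n - t)
    (hne : ∀ i ∈ Finset.Icc (1 : ℤ) (n - t + 1), m * n - i + a - b ≠ 0) :
    (({S : List Step | IsSchroeder m n t S ∧ IsSmall m S ∧ (dg S : ℤ) = a ∧
        (cd m S : ℤ) = b}.ncard : ℚ))
      = ∑ i ∈ Finset.Icc (1 : ℤ) (n - t + 1),
          ((((n - i) * (m * n - i + a + 1) : ℤ) : ℚ) / (((n * (m * n - i + a - b) : ℤ)) : ℚ)
            - ((n - t - i + 1 : ℤ) : ℚ) / ((n - t + 1 : ℤ) : ℚ)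
            + (((b + 1) * (m - 1) : ℤ) : ℚ) / ((m * n - i + a - b : ℤ) : ℚ))
          * ((C (m * n - i + a - b) (a - b) : ℤ) : ℚ)
          * ((C (n - t + 1) (n - t - i + 1) : ℤ) : ℚ)
          * ((C (m * n) (i - a - 1) : ℤ) : ℚ) := by
  lift m to ℕ using hm.le
  lift t to ℕ using ht.le
  lift b to ℕ using hb
  lift a to ℕ using by lia
  obtain ⟨p, rfl⟩ : ∃ p : ℕ, n = (t + p + a : ℕ) := ⟨(n - t - a).toNat, by lia⟩
  have hba' : b ≤ a := mod_cast hba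
  have hm' : 0 < m := mod_cast hm
  have ht' : 0 < t := mod_cast ht
  have hM : 0 < m * (t + p + a) := by positivity
  rw [ncard_schroeder, ← Int.cast_natCast (R := ℚ),
    completions_eq_biCoeff hm' (Nat.mul_pos hm' ht') rfl
      (show m * t + m * (p + a) = m * (t + p + a) by ring),
    biCoeff_countSeries _ _ _ _ _ _ hba' hM,
    show ((t + p + a : ℕ) - t + 1 : ℤ) = p + a + 1 by lia, sum_Icc_one_eq_sum_range, Int.cast_sum]
  · refine Finset.sum_congr rfl fun j hj ↦ ?_
    have hjp : j ≤ p := Finset.mem_range_succ_iff.mp hj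
    have hk := hne (p + a + 1 - j) (by rw [Finset.mem_Icc]; lia)
    rw [show ((m : ℤ) * (t + p + a : ℕ) - (p + a + 1 - j) + a - b) =
      ((m * (t + p + a) : ℕ) - (p - j : ℕ) - b - 1 : ℤ) by push_cast [hjp]; ring] at hk ⊢
    rw [show ((t + p + a : ℕ) - t - (p + a + 1 - j) + 1 : ℤ) = j by lia,
      show (p + a + 1 - j - a - 1 : ℤ) = (p - j : ℕ) by lia, ← Nat.cast_sub hba',
      show ((m : ℤ) * (t + p + a : ℕ)) = (m * (t + p + a) : ℕ) by push_cast; ring,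
      show (p + a + 1 : ℤ) = (p + a + 1 : ℕ) by push_cast; ring,
      C_natCast_natCast, C_natCast_natCast, C_natCast_right]
    have hA := mul_natChoose (p + a) j
    have hB := mul_natChoose (m * (t + p + a) - 1) (p - j)
    have hK := mul_ringChoose_sub_one ((m * (t + p + a) : ℕ) - (p - j : ℕ) - b - 1) (a - b)
    rw [Nat.sub_add_cancel hM, Nat.cast_sub (Nat.one_le_of_lt hM), Nat.cast_one,
      sub_add_cancel] at hB
    replace hA := congrArg (Int.cast : ℤ → ℚ) hA
    replace hB := congrArg (Int.cast : ℤ → ℚ) hB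
    replace hK := congrArg (Int.cast : ℤ → ℚ) hK
    replace hk := Int.cast_ne_zero (α := ℚ) |>.mpr hk
    simp only [Int.cast_mul, Int.cast_add, Int.cast_sub, Int.cast_natCast, Int.cast_one]
      at hA hB hK hk ⊢
    have key := summand_identity (m := m) (n := (t + p + a : ℕ)) (N := (p + a : ℕ)) (j := j)
      (c := (p - j : ℕ)) (r := (a - b : ℕ)) (i := p + a + 1 - j) (a := a) (b := b)
      (by positivity) (by positivity) (by positivity) hk
      (by push_cast; ring) (by push_cast [hjp]; ring) (by push_cast [hba']; ring)
      (by push_cast [hjp]; ring) hA (by rw [← Nat.cast_mul]; exact hB) hK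
    push_cast at key ⊢
    exact key
  · intro i _ hi
    rw [C_of_neg (show i - a - 1 < 0 by lia)]
    simp
end

section
/- (Ehrhart reciprocity for Fuß–Narayana numbers, denominator-cleared form.) For all integers m, n ≥ 1 and every integer k with 0 ≤ k ≤ n−1, the following identity holds in ℚ: −C(n−1, k)·C(−mn−1, k+1) = (−1)^k · Σ_{i=0}^{k} C(n−1, i)·C(mn+1, i+1)·C(n−1−i, n−1−k). (This is the identity Nar⁺(−m,n,n−1−k) = (−1)^k Σ_{i=0}^{k} Nar(m,n,n−1−i)·C(n−1−i, n−1−k), where Nar(m,n,j) = C(n−1, n−j−1)·C(mn+1, n−j)/(mn+1) and Nar⁺(m,n,j) = C(n−1, n−j−1)·C(mn−1, n−j)/(mn−1), after multiplying both sides by mn+1.) -/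
theorem C_natCast (p q : ℕ) : C p q = (p.choose q : ℤ) := by
  simp [C]

theorem C_neg_natCast (p q : ℕ) :
    C (-(p : ℤ) - 1) q = (-1) ^ q * ((p + q).choose q : ℤ) := by
  have hp : ¬ (0 : ℤ) ≤ -(p : ℤ) - 1 := by omega
  have hpq : ((q : ℤ) - (-(p : ℤ) - 1) - 1).toNat = p + q := by omega
  rw [C, if_neg (by omega), if_neg hp, hpq, Int.toNat_natCast]

theorem sum_choose_mul_choose_succ (a k : ℕ) :
    ∑ i ∈ Finset.range (k + 1), k.choose i * a.choose (i + 1) = (a + k).choose (k + 1) := by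
  rw [Nat.add_choose_eq, Finset.Nat.sum_antidiagonal_eq_sum_range_succ_mk,
    Finset.sum_range_succ' _ (k + 1)]
  simp only [Nat.sub_zero, Nat.choose_succ_self, mul_zero, add_zero]
  refine Finset.sum_congr rfl fun i hi => ?_
  rw [Nat.add_sub_add_right, Nat.choose_symm (Finset.mem_range_succ_iff.mp hi), mul_comm]

theorem choose_mul_choose_sub {N k i : ℕ} (hk : k ≤ N) (hi : i ≤ k) :
    N.choose i * (N - i).choose (N - k) = N.choose k * k.choose i := by
  rw [Nat.choose_mul hi, ← Nat.choose_symm (Nat.sub_le_sub_right hk i),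
    Nat.sub_sub_sub_cancel_right hi]

theorem sum_choose_mul_choose_mul_choose (a : ℕ) {N k : ℕ} (hk : k ≤ N) :
    ∑ i ∈ Finset.range (k + 1), N.choose i * a.choose (i + 1) * (N - i).choose (N - k)
      = N.choose k * (a + k).choose (k + 1) := by
  rw [← sum_choose_mul_choose_succ, Finset.mul_sum]
  refine Finset.sum_congr rfl fun i hi => ?_
  rw [← mul_assoc, ← choose_mul_choose_sub hk (Finset.mem_range_succ_iff.mp hi)]
  ring

theorem sum_Icc_zero_natCast {M : Type*} [AddCommMonoid M] (f : ℤ → M) (k : ℕ) :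
    ∑ i ∈ Finset.Icc (0 : ℤ) k, f i = ∑ i ∈ Finset.range (k + 1), f i := by
  symm
  refine Finset.sum_nbij (fun i : ℕ => (i : ℤ)) ?_ ?_ ?_ fun _ _ => rfl
  · intro i hi
    simp only [Finset.mem_range, Finset.mem_Icc] at hi ⊢
    omega
  · exact fun _ _ _ _ h => Int.ofNat_inj.mp h
  · intro i hi
    simp only [Finset.coe_Icc, Set.mem_Icc] at hi
    exact ⟨i.toNat, by simp only [Finset.coe_range, Set.mem_Iio]; omega, by simp [hi.1]⟩

/-- Ehrhart reciprocity for Fuß–Narayana numbers, denominator-cleared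
form. -/
theorem statement11 (m n k : ℤ) (hm : 1 ≤ m) (hn : 1 ≤ n) (hk0 : 0 ≤ k) (hk : k ≤ n - 1) :
    -((C (n - 1) k * C (-(m * n) - 1) (k + 1) : ℤ) : ℚ)
      = (-1 : ℚ) ^ k.toNat
        * ∑ i ∈ Finset.Icc (0 : ℤ) k,
            ((C (n - 1) i * C (m * n + 1) (i + 1) * C (n - 1 - i) (n - 1 - k) : ℤ) : ℚ) := by
  lift k to ℕ using hk0
  obtain ⟨N, rfl⟩ : ∃ N : ℕ, n = N + 1 := ⟨(n - 1).toNat, by omega⟩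
  obtain ⟨b, hb⟩ : ∃ b : ℕ, m * ((N : ℤ) + 1) = b :=
    ⟨(m * (N + 1)).toNat, (Int.toNat_of_nonneg (by positivity)).symm⟩
  have hkN : k ≤ N := by omega
  have hterm : ∀ i ∈ Finset.range (k + 1),
      C N i * C (b + 1) (i + 1) * C ((N : ℤ) - i) ((N : ℤ) - k)
        = ((N.choose i * (b + 1).choose (i + 1) * (N - i).choose (N - k) : ℕ) : ℤ) := by
    intro i hi
    have hik : i ≤ k := Finset.mem_range_succ_iff.mp hi
    rw [← Nat.cast_sub hkN, ← Nat.cast_sub (hik.trans hkN)]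
    exact_mod_cast congrArg₂ (· * ·) (congrArg₂ (· * ·) (C_natCast N i)
      (C_natCast (b + 1) (i + 1))) (C_natCast (N - i) (N - k))
  have hneg : C (-(b : ℤ) - 1) ((k : ℤ) + 1)
      = (-1) ^ (k + 1) * ((b + 1 + k).choose (k + 1) : ℤ) := by
    rw [add_right_comm b 1 k, add_assoc b k 1]
    exact_mod_cast C_neg_natCast b (k + 1)
  rw [hb, add_sub_cancel_right, sum_Icc_zero_natCast, ← Int.cast_sum,
    Finset.sum_congr rfl hterm, ← Nat.cast_sum, sum_choose_mul_choose_mul_choose _ hkN,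
    hneg, C_natCast, Int.toNat_natCast]
  push_cast
  ring
end
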